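/- Let λ > 0 and let y be a nontrivial real-valued solution on [0,1] of the equation [y‴ − λPy]′ + λPy′ = 0 which for some point a ∈ (0,1] satisfies y(a) ≥ 0, y′(a) ≤ 0, y″(a) ≥ 0 and y‴(a) ≤ 0. Then y(0) > 0, y′(0) < 0, y″(0) > 0 and y‴(0) < 0. -/

import Mathlib

open Set Filter

/-- First derivative on `[0,1]` (one-sided at the endpoints). -/
noncomputable def Y1 (y : ℝ → ℝ) : ℝ → ℝ := derivWithin y (Set.Icc 0 1)
/-- Second derivative on `[0,1]`. -/
noncomputable def Y2 (y : ℝ → ℝ) : ℝ → ℝ := iteratedDerivWithin 2 y (Set.Icc 0 1)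
/-- Third derivative on `[0,1]`. -/
noncomputable def Y3 (y : ℝ → ℝ) : ℝ → ℝ := iteratedDerivWithin 3 y (Set.Icc 0 1)

/-- `y` is a solution on `[0,1]` of `[y''' - λ P y]' + λ P y' = 0`:
`y ∈ C³[0,1]` and `y''' - λ P y` is (continuously) differentiable on `[0,1]`
with derivative `-λ P y'`. -/
def SolutionOn (P : ℝ → ℝ) (lam : ℝ) (y : ℝ → ℝ) : Prop :=
  ContDiffOn ℝ 3 y (Set.Icc 0 1) ∧
  ∀ x ∈ Set.Icc (0:ℝ) 1,
    HasDerivWithinAt (fun t => Y3 y t - lam * P t * y t)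
      (-(lam * P x * Y1 y x)) (Set.Icc 0 1) x

/-- `y` is not identically zero on `[0,1]`. -/
def Nontrivial01 (y : ℝ → ℝ) : Prop := ∃ x ∈ Set.Icc (0:ℝ) 1, y x ≠ 0

/-- The boundary conditions of the problem `(α, β)`. -/
def BC (α β : ℝ) (y : ℝ → ℝ) : Prop :=
  Y2 y 0 + α * y 0 - β * Y1 y 0 = 0 ∧
  -β * Y3 y 0 + α * Y2 y 0 = 0 ∧
  Y2 y 1 + α * y 1 + β * Y1 y 1 = 0 ∧
  -β * Y3 y 1 - α * Y2 y 1 = 0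

/-- `y` is an eigenfunction of the problem `(α, β)` with eigenvalue `lam`. -/
def Eigenfunction (P : ℝ → ℝ) (α β lam : ℝ) (y : ℝ → ℝ) : Prop :=
  Nontrivial01 y ∧ SolutionOn P lam y ∧ BC α β y

/-- `lam` is an eigenvalue of the problem `(α, β)`. -/
def IsEigenvalue (P : ℝ → ℝ) (α β lam : ℝ) : Prop :=
  ∃ y : ℝ → ℝ, Eigenfunction P α β lam y

/-- The number `b = (1 - κ a)/(κ - 1)`. -/
noncomputable def bb (κ : ℕ) (a : ℝ) : ℝ := (1 - κ * a) / (κ - 1)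

/-- `P` is a nondecreasing continuous function on `[0,1]` with `P 0 = 0`, `P 1 = 1`,
self-similar of Cantor type with parameters `κ ≥ 2` and `0 < a < 1/κ`. -/
def CantorSelfSimilar (P : ℝ → ℝ) (κ : ℕ) (a : ℝ) : Prop :=
  ContinuousOn P (Set.Icc 0 1) ∧ MonotoneOn P (Set.Icc 0 1) ∧
  P 0 = 0 ∧ P 1 = 1 ∧ 2 ≤ κ ∧ 0 < a ∧ a < 1 / κ ∧
  (∀ k : ℕ, k < κ → ∃ c : ℝ, ∀ x ∈ Set.Icc (0:ℝ) 1,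
      (κ : ℝ) * P (k * (a + bb κ a) + a * x) = P x + c) ∧
  (∀ k : ℕ, 1 ≤ k → k < κ →
      ∀ x ∈ Set.Ioo ((k:ℝ) * (a + bb κ a) - bb κ a) ((k:ℝ) * (a + bb κ a)),
      ∀ x' ∈ Set.Ioo ((k:ℝ) * (a + bb κ a) - bb κ a) ((k:ℝ) * (a + bb κ a)),
      P x = P x')

/-- A function with nonnegative derivative on `[0,T]` from `r` on does not decrease from `r` to `s`. -/
theorem le_of_hasDerivWithinAt_nonneg {T r s : ℝ} {f f' : ℝ → ℝ}
    (hf : ∀ x ∈ Icc 0 T, HasDerivWithinAt f (f' x) (Icc 0 T) x)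
    (hr : 0 ≤ r) (hrs : r ≤ s) (hs : s ≤ T) (hf' : ∀ x ∈ Icc r s, 0 ≤ f' x) : f r ≤ f s := by
  have hsub : Icc r s ⊆ Icc 0 T := Icc_subset_Icc hr hs
  refine monotoneOn_of_hasDerivWithinAt_nonneg (f' := f') (convex_Icc r s)
    (fun x hx => ((hf x (hsub hx)).mono hsub).continuousWithinAt)
    (fun x hx => (hf x (hsub (interior_subset hx))).mono (interior_subset.trans hsub))
    (fun x hx => hf' x (interior_subset hx)) (left_mem_Icc.2 hrs) (right_mem_Icc.2 hrs) hrs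

theorem pos_of_hasDerivWithinAt_pos {T r : ℝ} {f f' : ℝ → ℝ}
    (hf : ∀ x ∈ Icc 0 T, HasDerivWithinAt f (f' x) (Icc 0 T) x)
    (hr : 0 ≤ r) (hfr : 0 ≤ f r) (hf' : ∀ x ∈ Ioc r T, 0 < f' x) :
    ∀ x ∈ Ioc r T, 0 < f x := by
  intro s hs
  have hsub : Icc r s ⊆ Icc 0 T := Icc_subset_Icc hr hs.2
  refine hfr.trans_lt (strictMonoOn_of_hasDerivWithinAt_pos (f' := f') (convex_Icc r s)
    (fun x hx => ((hf x (hsub hx)).mono hsub).continuousWithinAt)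
    (fun x hx => (hf x (hsub (interior_subset hx))).mono (interior_subset.trans hsub))
    (fun x hx => ?_) (left_mem_Icc.2 hs.1.le) (right_mem_Icc.2 hs.1.le) hs.1)
  rw [interior_Icc] at hx
  exact hf' x ⟨hx.1, hx.2.le.trans hs.2⟩

/-- Integrating a lower bound of exponential type. -/
theorem neg_exp_le_of_hasDerivWithinAt {T s C L : ℝ} {f f' : ℝ → ℝ} (hL : 0 < L) (hC : 0 ≤ C)
    (hf : ∀ x ∈ Icc 0 T, HasDerivWithinAt f (f' x) (Icc 0 T) x) (hf0 : 0 ≤ f 0)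
    (hs : s ∈ Icc 0 T) (hf' : ∀ x ∈ Icc 0 s, -(C * Real.exp (L * x)) ≤ f' x) :
    -(C / L * Real.exp (L * s)) ≤ f s := by
  have hg : ∀ x ∈ Icc 0 T, HasDerivWithinAt (fun t => f t + C / L * Real.exp (L * t))
      (f' x + C * Real.exp (L * x)) (Icc 0 T) x := by
    intro x hx
    have h : HasDerivAt (fun t => C / L * Real.exp (L * t)) (C * Real.exp (L * x)) x := by
      have h1 := (((hasDerivAt_id x).const_mul L).exp).const_mul (C / L)
      refine h1.congr_deriv ?_
      simp only [id]
      field_simp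
    exact (hf x hx).add h.hasDerivWithinAt
  have := le_of_hasDerivWithinAt_nonneg hg le_rfl hs.1 hs.2
    (fun x hx => by linarith [hf' x hx])
  simp only [mul_zero, Real.exp_zero, mul_one] at this
  have : 0 ≤ C / L := by positivity
  linarith

/-- The first order form on `[0,T]` of the equation `(v₃ - λ Q v₀)' + λ Q v₁ = 0` with a
nondecreasing `Q`. -/
structure BeamSystem (lam T : ℝ) (Q v₀ v₁ v₂ v₃ : ℝ → ℝ) : Prop where
  mono : MonotoneOn Q (Icc 0 T)
  deriv₀ : ∀ x ∈ Icc 0 T, HasDerivWithinAt v₀ (v₁ x) (Icc 0 T) x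
  deriv₁ : ∀ x ∈ Icc 0 T, HasDerivWithinAt v₁ (v₂ x) (Icc 0 T) x
  deriv₂ : ∀ x ∈ Icc 0 T, HasDerivWithinAt v₂ (v₃ x) (Icc 0 T) x
  deriv₃ : ∀ x ∈ Icc 0 T, HasDerivWithinAt (fun t => v₃ t - lam * Q t * v₀ t)
    (-(lam * Q x * v₁ x)) (Icc 0 T) x

namespace BeamSystem

variable {lam T : ℝ} {Q v₀ v₁ v₂ v₃ : ℝ → ℝ}

theorem neg (h : BeamSystem lam T Q v₀ v₁ v₂ v₃) :
    BeamSystem lam T Q (-v₀) (-v₁) (-v₂) (-v₃) where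
  mono := h.mono
  deriv₀ x hx := (h.deriv₀ x hx).neg
  deriv₁ x hx := (h.deriv₁ x hx).neg
  deriv₂ x hx := (h.deriv₂ x hx).neg
  deriv₃ x hx := by
    refine ((h.deriv₃ x hx).neg.congr_deriv ?_).congr_of_mem (fun t _ => ?_) hx <;>
      simp only [Pi.neg_apply] <;> ring

/-- The quasi-derivative adapted to a fixed value `q` of the coefficient. -/
theorem hasDerivWithinAt_shift (h : BeamSystem lam T Q v₀ v₁ v₂ v₃) (q : ℝ) :
    ∀ x ∈ Icc 0 T, HasDerivWithinAt (fun t => v₃ t + lam * (q - Q t) * v₀ t)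
      (lam * (q - Q x) * v₁ x) (Icc 0 T) x := by
  intro x hx
  refine (((h.deriv₃ x hx).add ((h.deriv₀ x hx).const_mul (lam * q))).congr_deriv
    ?_).congr_of_mem (fun t _ => ?_) hx
  · ring
  · simp only [Pi.add_apply]
    ring

theorem nonneg₁ (h : BeamSystem lam T Q v₀ v₁ v₂ v₃) (hlam : 0 < lam) (hT : 0 ≤ T)
    (h₀ : 0 ≤ v₀ 0) (h₁ : 0 ≤ v₁ 0) (h₂ : 0 ≤ v₂ 0) (h₃ : 0 ≤ v₃ 0) :
    ∀ x ∈ Icc 0 T, 0 ≤ v₁ x := by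
  have h0T : (0 : ℝ) ∈ Icc 0 T := left_mem_Icc.2 hT
  have hTT : T ∈ Icc 0 T := right_mem_Icc.2 hT
  set D := Q T - Q 0 with hD
  have hD0 : 0 ≤ D := sub_nonneg.2 (h.mono h0T hTT hT)
  set L := lam * D + 1 with hL
  have hlD : 0 ≤ lam * D := by positivity
  have hL0 : 0 < L := by linarith
  have hcont : ContinuousOn (fun x => v₁ x * Real.exp (-(L * x))) (Icc 0 T) := by
    refine ContinuousOn.mul (fun x hx => (h.deriv₁ x hx).continuousWithinAt) ?_
    fun_prop
  obtain ⟨z, hz, hmin⟩ := isCompact_Icc.exists_isMinOn ⟨0, h0T⟩ hcont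
  set M := -(v₁ z * Real.exp (-(L * z))) with hM
  have hexp (x : ℝ) : Real.exp (-(L * x)) * Real.exp (L * x) = 1 := by
    rw [← Real.exp_add]; simp
  have hbound : ∀ x ∈ Icc 0 T, -(M * Real.exp (L * x)) ≤ v₁ x := by
    intro x hx
    have h1 : v₁ z * Real.exp (-(L * z)) ≤ v₁ x * Real.exp (-(L * x)) := hmin hx
    have h2 := mul_le_mul_of_nonneg_right h1 (Real.exp_pos (L * x)).le
    rw [mul_assoc (v₁ x), hexp] at h2
    rw [hM]
    linarith
  have hM0 : M ≤ 0 := by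
    by_contra! hMpos
    have b₃ : ∀ s ∈ Icc 0 T, -(lam * D * M / L * Real.exp (L * s)) ≤ v₃ s := by
      intro s hs
      have hQ0 : Q 0 ≤ Q s := h.mono h0T hs hs.1
      have := neg_exp_le_of_hasDerivWithinAt (C := lam * D * M) hL0 (by positivity)
        (h.hasDerivWithinAt_shift (Q s))
        (add_nonneg h₃ (mul_nonneg (mul_nonneg hlam.le (sub_nonneg.2 hQ0)) h₀)) hs ?_
      · simpa using this
      intro x hx
      have hxT : x ∈ Icc 0 T := ⟨hx.1, hx.2.trans hs.2⟩
      have hxs : 0 ≤ Q s - Q x := sub_nonneg.2 (h.mono hxT hs hx.2)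
      have hxD : Q s - Q x ≤ D := by
        have := h.mono h0T hxT hx.1
        have := h.mono hs hTT hs.2
        linarith
      have hMe : 0 ≤ M * Real.exp (L * x) := by positivity
      have i1 := mul_le_mul_of_nonneg_left (hbound x hxT) (mul_nonneg hlam.le hxs)
      have i2 := mul_le_mul_of_nonneg_right (mul_le_mul_of_nonneg_left hxD hlam.le) hMe
      linarith
    have b₂ : ∀ s ∈ Icc 0 T, -(lam * D * M / L / L * Real.exp (L * s)) ≤ v₂ s := fun s hs =>
      neg_exp_le_of_hasDerivWithinAt hL0 (by positivity) h.deriv₂ h₂ hs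
        (fun x hx => b₃ x ⟨hx.1, hx.2.trans hs.2⟩)
    have b₁ := neg_exp_le_of_hasDerivWithinAt hL0 (by positivity) h.deriv₁ h₁ hz
        (fun x hx => b₂ x ⟨hx.1, hx.2.trans hz.2⟩)
    have hlt : lam * D * M / L / L / L < M := by
      rw [div_div, div_div, div_lt_iff₀ (by positivity)]
      have h1 : 1 ≤ L := by linarith
      have h2 : L ≤ L * L * L := by nlinarith
      have h3 : lam * D < L * L * L := by linarith
      nlinarith
    have hv : v₁ z = -(M * Real.exp (L * z)) := by
      rw [hM, neg_mul, neg_neg, mul_assoc, hexp, mul_one]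
    have := mul_lt_mul_of_pos_right hlt (Real.exp_pos (L * z))
    linarith
  intro x hx
  have := mul_nonneg (neg_nonneg.2 hM0) (Real.exp_pos (L * x)).le
  linarith [hbound x hx]

theorem eq_zero (h : BeamSystem lam T Q v₀ v₁ v₂ v₃) (hlam : 0 < lam) (hT : 0 ≤ T)
    (h₀ : v₀ 0 = 0) (h₁ : v₁ 0 = 0) (h₂ : v₂ 0 = 0) (h₃ : v₃ 0 = 0) :
    ∀ x ∈ Icc 0 T, v₀ x = 0 := by
  intro x hx
  have hp := h.nonneg₁ hlam hT h₀.ge h₁.ge h₂.ge h₃.ge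
  have hn := h.neg.nonneg₁ hlam hT (by simp [h₀]) (by simp [h₁]) (by simp [h₂]) (by simp [h₃])
  have i1 := le_of_hasDerivWithinAt_nonneg h.deriv₀ le_rfl hx.1 hx.2
    (fun t ht => hp t ⟨ht.1, ht.2.trans hx.2⟩)
  have i2 := le_of_hasDerivWithinAt_nonneg h.neg.deriv₀ le_rfl hx.1 hx.2
    (fun t ht => hn t ⟨ht.1, ht.2.trans hx.2⟩)
  simp only [Pi.neg_apply] at i2
  linarith

/-- Nonnegative nonzero data at `0` become positive at `T`, if `Q` increases before `T`. -/
theorem pos_right (h : BeamSystem lam T Q v₀ v₁ v₂ v₃) (hlam : 0 < lam)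
    (h₀ : 0 ≤ v₀ 0) (h₁ : 0 ≤ v₁ 0) (h₂ : 0 ≤ v₂ 0) (h₃ : 0 ≤ v₃ 0)
    (hne : ¬(v₀ 0 = 0 ∧ v₁ 0 = 0 ∧ v₂ 0 = 0 ∧ v₃ 0 = 0))
    {r s : ℝ} (hr : 0 < r) (hrs : r < s) (hsT : s < T) (hQ : Q r < Q s) :
    0 < v₀ T ∧ 0 < v₁ T ∧ 0 < v₂ T ∧ 0 < v₃ T := by
  have hs : 0 < s := hr.trans hrs
  have hT : 0 < T := hs.trans hsT
  have n₁ := h.nonneg₁ hlam hT.le h₀ h₁ h₂ h₃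
  have n₀ : ∀ x ∈ Icc 0 T, v₀ 0 ≤ v₀ x := fun x hx =>
    le_of_hasDerivWithinAt_nonneg h.deriv₀ le_rfl hx.1 hx.2
      (fun t ht => n₁ t ⟨ht.1, ht.2.trans hx.2⟩)
  have inc₃ : ∀ x ∈ Icc 0 T, ∀ z ∈ Icc x T, v₃ x + lam * (Q z - Q x) * v₀ x ≤ v₃ z := by
    intro x hx z hz
    have hzT : z ∈ Icc 0 T := ⟨hx.1.trans hz.1, hz.2⟩
    have := le_of_hasDerivWithinAt_nonneg (h.hasDerivWithinAt_shift (Q z)) hx.1 hz.1 hz.2 ?_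
    · simpa using this
    intro t ht
    have htT : t ∈ Icc 0 T := ⟨hx.1.trans ht.1, ht.2.trans hz.2⟩
    exact mul_nonneg (mul_nonneg hlam.le (sub_nonneg.2 (h.mono htT hzT ht.2))) (n₁ t htT)
  have mono₃ : ∀ x ∈ Icc 0 T, ∀ z ∈ Icc x T, v₃ x ≤ v₃ z := by
    intro x hx z hz
    have hQz : Q x ≤ Q z := h.mono hx ⟨hx.1.trans hz.1, hz.2⟩ hz.1
    have := mul_nonneg (mul_nonneg hlam.le (sub_nonneg.2 hQz)) (h₀.trans (n₀ x hx))
    linarith [inc₃ x hx z hz]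
  have h0T : (0 : ℝ) ∈ Icc 0 T := left_mem_Icc.2 hT.le
  have n₃ : ∀ x ∈ Icc 0 T, v₃ 0 ≤ v₃ x := mono₃ 0 h0T
  have n₂ : ∀ x ∈ Icc 0 T, v₂ 0 ≤ v₂ x := fun x hx =>
    le_of_hasDerivWithinAt_nonneg h.deriv₂ le_rfl hx.1 hx.2
      (fun t ht => h₃.trans (n₃ t ⟨ht.1, ht.2.trans hx.2⟩))
  have m₁ : ∀ x ∈ Icc 0 T, v₁ 0 ≤ v₁ x := fun x hx =>
    le_of_hasDerivWithinAt_nonneg h.deriv₁ le_rfl hx.1 hx.2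
      (fun t ht => h₂.trans (n₂ t ⟨ht.1, ht.2.trans hx.2⟩))
  have pos₀ : ∀ x ∈ Ioc 0 T, 0 < v₀ x := by
    rcases h₀.lt_or_eq with p | e₀
    · exact fun x hx => p.trans_le (n₀ x ⟨hx.1.le, hx.2⟩)
    refine pos_of_hasDerivWithinAt_pos h.deriv₀ le_rfl h₀ ?_
    rcases h₁.lt_or_eq with p | e₁
    · exact fun x hx => p.trans_le (m₁ x ⟨hx.1.le, hx.2⟩)
    refine pos_of_hasDerivWithinAt_pos h.deriv₁ le_rfl h₁ ?_
    rcases h₂.lt_or_eq with p | e₂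
    · exact fun x hx => p.trans_le (n₂ x ⟨hx.1.le, hx.2⟩)
    refine pos_of_hasDerivWithinAt_pos h.deriv₂ le_rfl h₂ ?_
    rcases h₃.lt_or_eq with p | e₃
    · exact fun x hx => p.trans_le (n₃ x ⟨hx.1.le, hx.2⟩)
    exact absurd ⟨e₀.symm, e₁.symm, e₂.symm, e₃.symm⟩ hne
  have hsI : s ∈ Icc 0 T := ⟨hs.le, hsT.le⟩
  have hrT : r < T := hrs.trans hsT
  have hTs : T ∈ Ioc s T := ⟨hsT, le_rfl⟩
  have p₃s : 0 < v₃ s := by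
    have hrI : r ∈ Icc 0 T := ⟨hr.le, hrT.le⟩
    have := mul_pos (mul_pos hlam (sub_pos.2 hQ)) (pos₀ r ⟨hr, hrT.le⟩)
    linarith [inc₃ r hrI s ⟨hrs.le, hsT.le⟩, n₃ r hrI]
  have p₃ : ∀ x ∈ Ioc s T, 0 < v₃ x := fun x hx =>
    p₃s.trans_le (mono₃ s hsI x ⟨hx.1.le, hx.2⟩)
  have p₂ := pos_of_hasDerivWithinAt_pos h.deriv₂ hs.le (h₂.trans (n₂ s hsI)) p₃
  have p₁ := pos_of_hasDerivWithinAt_pos h.deriv₁ hs.le (n₁ s hsI) p₂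
  exact ⟨pos₀ T ⟨hT, le_rfl⟩, p₁ T hTs, p₂ T hTs, p₃ T hTs⟩

end BeamSystem

theorem CantorSelfSimilar.map_mul {P : ℝ → ℝ} {κ : ℕ} {a : ℝ} (hP : CantorSelfSimilar P κ a) :
    ∀ x ∈ Icc (0 : ℝ) 1, (κ : ℝ) * P (a * x) = P x := by
  obtain ⟨-, -, hP0, -, hκ, -, -, hself, -⟩ := hP
  obtain ⟨c, hc⟩ := hself 0 (by omega)
  have hc0 := hc 0 ⟨le_rfl, zero_le_one⟩
  simp only [Nat.cast_zero, zero_mul, zero_add, mul_zero, hP0] at hc hc0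
  intro x hx
  rw [hc x hx, ← hc0, add_zero]

theorem CantorSelfSimilar.lt_one {P : ℝ → ℝ} {κ : ℕ} {a : ℝ} (hP : CantorSelfSimilar P κ a) :
    a < 1 := by
  obtain ⟨-, -, -, -, hκ, -, ha, -⟩ := hP
  have : (1 : ℝ) ≤ κ := by exact_mod_cast (by omega : 1 ≤ κ)
  exact ha.trans_le ((div_le_one (by linarith)).2 this)

theorem CantorSelfSimilar.pos {P : ℝ → ℝ} {κ : ℕ} {a : ℝ} (hP : CantorSelfSimilar P κ a) :
    ∀ x ∈ Ioc (0 : ℝ) 1, 0 < P x := by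
  have hmap := hP.map_mul
  have ha1 := hP.lt_one
  obtain ⟨-, hmono, -, hP1, hκ, ha, -⟩ := hP
  have hpow (n : ℕ) : a ^ n ∈ Icc (0 : ℝ) 1 := ⟨by positivity, pow_le_one₀ ha.le ha1.le⟩
  have hpos (n : ℕ) : 0 < P (a ^ n) := by
    induction n with
    | zero => simp [hP1]
    | succ n ih =>
      rw [← hmap _ (hpow n), ← pow_succ'] at ih
      exact pos_of_mul_pos_right ih (Nat.cast_nonneg κ)
  intro x hx
  obtain ⟨n, hn⟩ := exists_pow_lt_of_lt_one hx.1 ha1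
  exact (hpos n).trans_le (hmono (hpow n) ⟨hx.1.le, hx.2⟩ hn.le)

theorem CantorSelfSimilar.map_mul_lt {P : ℝ → ℝ} {κ : ℕ} {a : ℝ} (hP : CantorSelfSimilar P κ a) :
    ∀ x ∈ Ioc (0 : ℝ) 1, P (a * x) < P x := by
  intro x hx
  have hpos := hP.pos x hx
  have hmap := hP.map_mul x ⟨hx.1.le, hx.2⟩
  have hκ : (2 : ℝ) ≤ κ := by exact_mod_cast hP.2.2.2.2.1
  nlinarith

theorem SolutionOn.beamSystem {P : ℝ → ℝ} {lam : ℝ} {y : ℝ → ℝ} (hy : SolutionOn P lam y)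
    (hP : MonotoneOn P (Icc 0 1)) : BeamSystem lam 1 P y (Y1 y) (Y2 y) (Y3 y) := by
  have hu : UniqueDiffOn ℝ (Icc (0 : ℝ) 1) := uniqueDiffOn_Icc zero_lt_one
  have key (m : ℕ) (hm : m < 3) (x : ℝ) (hx : x ∈ Icc (0 : ℝ) 1) :
      HasDerivWithinAt (iteratedDerivWithin m y (Icc 0 1))
        (iteratedDerivWithin (m + 1) y (Icc 0 1) x) (Icc 0 1) x := by
    rw [iteratedDerivWithin_succ]
    exact (hy.1.differentiableOn_iteratedDerivWithin (by exact_mod_cast hm) hu x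
      hx).hasDerivWithinAt
  refine ⟨hP, fun x hx => ?_, fun x hx => ?_, key 2 (by norm_num), hy.2⟩
  · simpa [Y1, iteratedDerivWithin_one] using key 0 (by norm_num) x hx
  · simpa [Y1, Y2, iteratedDerivWithin_one] using key 1 (by norm_num) x hx

namespace BeamSystem

variable {lam t : ℝ} {P y₀ y₁ y₂ y₃ : ℝ → ℝ}

/-- Reflection at `t` of the restriction to `[0,t]`. -/
theorem reflect (h : BeamSystem lam 1 P y₀ y₁ y₂ y₃) (ht : t ≤ 1) :
    BeamSystem lam t (fun s => -P (t - s)) (fun s => y₀ (t - s)) (fun s => -y₁ (t - s))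
      (fun s => y₂ (t - s)) (fun s => -y₃ (t - s)) := by
  have hmap : MapsTo (fun s => t - s) (Icc 0 t) (Icc 0 1) := fun s hs =>
    ⟨by linarith [hs.2], by linarith [hs.1]⟩
  have comp {f f' : ℝ → ℝ} (hf : ∀ x ∈ Icc 0 1, HasDerivWithinAt f (f' x) (Icc 0 1) x) :
      ∀ x ∈ Icc 0 t, HasDerivWithinAt (fun s => f (t - s)) (-f' (t - x)) (Icc 0 t) x := by
    intro x hx
    have h1 : HasDerivWithinAt (fun s => t - s) (-1) (Icc 0 t) x :=
      ((hasDerivAt_id x).const_sub t).hasDerivWithinAt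
    exact ((hf _ (hmap hx)).comp x h1 hmap).congr_deriv (by ring)
  refine ⟨fun x hx z hz hxz => neg_le_neg (h.mono (hmap hz) (hmap hx) (by linarith)),
    comp h.deriv₀, fun x hx => ?_, comp h.deriv₂, fun x hx => ?_⟩
  · exact (comp h.deriv₁ x hx).neg.congr_deriv (neg_neg _)
  · refine ((comp h.deriv₃ x hx).neg.congr_deriv (by ring)).congr_of_mem (fun s _ => ?_) hx
    simp only [Pi.neg_apply]
    ring

/-- Translation to the origin of the restriction to `[t,1]`. -/
theorem translate (h : BeamSystem lam 1 P y₀ y₁ y₂ y₃) (ht : 0 ≤ t) :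
    BeamSystem lam (1 - t) (fun s => P (t + s)) (fun s => y₀ (t + s)) (fun s => y₁ (t + s))
      (fun s => y₂ (t + s)) (fun s => y₃ (t + s)) := by
  have hmap : MapsTo (fun s => t + s) (Icc 0 (1 - t)) (Icc 0 1) := fun s hs =>
    ⟨by linarith [hs.1], by linarith [hs.2]⟩
  have comp {f f' : ℝ → ℝ} (hf : ∀ x ∈ Icc 0 1, HasDerivWithinAt f (f' x) (Icc 0 1) x) :
      ∀ x ∈ Icc 0 (1 - t),
        HasDerivWithinAt (fun s => f (t + s)) (f' (t + x)) (Icc 0 (1 - t)) x := by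
    intro x hx
    have h1 : HasDerivWithinAt (fun s => t + s) 1 (Icc 0 (1 - t)) x :=
      ((hasDerivAt_id x).const_add t).hasDerivWithinAt
    exact ((hf _ (hmap hx)).comp x h1 hmap).congr_deriv (by ring)
  exact ⟨fun x hx z hz hxz => h.mono (hmap hx) (hmap hz) (by linarith),
    comp h.deriv₀, comp h.deriv₁, comp h.deriv₂, comp h.deriv₃⟩

theorem eq_zero_of_data_eq_zero (h : BeamSystem lam 1 P y₀ y₁ y₂ y₃) (hlam : 0 < lam)
    (ht : t ∈ Icc (0 : ℝ) 1) (h₀ : y₀ t = 0) (h₁ : y₁ t = 0) (h₂ : y₂ t = 0) (h₃ : y₃ t = 0) :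
    ∀ x ∈ Icc (0 : ℝ) 1, y₀ x = 0 := by
  intro x hx
  rcases le_total x t with hxt | hxt
  · simpa using (h.reflect ht.2).eq_zero hlam ht.1 (by simpa) (by simpa) (by simpa) (by simpa)
      (t - x) ⟨by linarith, by linarith [hx.1]⟩
  · simpa using (h.translate ht.1).eq_zero hlam (by linarith [ht.2]) (by simpa) (by simpa)
      (by simpa) (by simpa) (x - t) ⟨by linarith, by linarith [hx.2]⟩

end BeamSystem

theorem stmt1 (P : ℝ → ℝ) (κ : ℕ) (a : ℝ) (hP : CantorSelfSimilar P κ a)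
    (lam : ℝ) (hlam : 0 < lam) (y : ℝ → ℝ)
    (hy : SolutionOn P lam y) (hnt : Nontrivial01 y)
    (t0 : ℝ) (ht0 : t0 ∈ Set.Ioc (0:ℝ) 1)
    (h0 : 0 ≤ y t0) (h1 : Y1 y t0 ≤ 0) (h2 : 0 ≤ Y2 y t0) (h3 : Y3 y t0 ≤ 0) :
    0 < y 0 ∧ Y1 y 0 < 0 ∧ 0 < Y2 y 0 ∧ Y3 y 0 < 0 := by
  have hsys := hy.beamSystem hP.2.1
  have hne : ¬(y t0 = 0 ∧ Y1 y t0 = 0 ∧ Y2 y t0 = 0 ∧ Y3 y t0 = 0) := by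
    rintro ⟨e₀, e₁, e₂, e₃⟩
    obtain ⟨x, hx, hyx⟩ := hnt
    exact hyx (hsys.eq_zero_of_data_eq_zero hlam ⟨ht0.1.le, ht0.2⟩ e₀ e₁ e₂ e₃ x hx)
  have ha : 0 < a := hP.2.2.2.2.2.1
  have ha1 := hP.lt_one
  have hpos : 0 < t0 / 2 := half_pos ht0.1
  have hat : a * (t0 / 2) < t0 / 2 := by nlinarith
  have hlt := hP.map_mul_lt (t0 / 2) ⟨hpos, by linarith [ht0.2]⟩
  have := (hsys.reflect ht0.2).pos_right hlam (by simpa using h0) (by simpa using h1)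
    (by simpa using h2) (by simpa using h3) (by simpa using hne)
    (r := t0 - t0 / 2) (s := t0 - a * (t0 / 2)) (by linarith) (by linarith)
    (by linarith [mul_pos ha hpos]) (by simpa using hlt)
  simpa using this
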